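/- Let 𝔹 be an additive bivariant theory over a functoriality with good coproducts, let X → Y₁ ⊔ Y₂ be a morphism, and let Xᵢ := X ×_{Y₁ ⊔ Y₂} Yᵢ with induced maps ι'ᵢ : Xᵢ → X and canonical inclusions ιᵢ : Yᵢ → Y₁ ⊔ Y₂. Then the map (ι₁^*, ι₂^*) : 𝔹(X → Y₁ ⊔ Y₂) → 𝔹(X₁ → Y₁) ⊕ 𝔹(X₂ → Y₂) is an isomorphism, whose inverse sends (α₁, α₂) to ι'₁_*(α₁ • θ(ι₁)) + ι'₂_*(α₂ • θ(ι₂)). -/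

import Mathlib

open CategoryTheory CategoryTheory.Limits

universe w w' u' v u

/-- A bivariant functoriality on a category `C` with a final object and all fiber
products: a class of confined morphisms (containing all isomorphisms, closed under
composition and pullback), a class of independent Cartesian squares (containing all
squares in which one pair of parallel sides consists of identities, closed under
horizontal and vertical composition) and a class of specialized morphisms
(containing all isomorphisms and closed under composition).

A square is recorded by its bottom `bot : X ⟶ Y`, top `top : X' ⟶ Y'`, left
vertical `l : X' ⟶ X` and right vertical `r : Y' ⟶ Y`; it is Cartesian when
`IsPullback top l r bot` holds. -/
structure BivFun (C : Type u) [Category.{v} C] where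
  pt : C
  isTerminal_pt : IsTerminal pt
  hasPullbacks : HasPullbacks C
  confined : ∀ ⦃X Y : C⦄, (X ⟶ Y) → Prop
  confined_of_isIso : ∀ ⦃X Y : C⦄ (f : X ⟶ Y), IsIso f → confined f
  confined_comp : ∀ ⦃X Y Z : C⦄ {f : X ⟶ Y} {g : Y ⟶ Z},
    confined f → confined g → confined (f ≫ g)
  confined_pullback : ∀ ⦃X Y X' Y' : C⦄ {bot : X ⟶ Y} {top : X' ⟶ Y'} {l : X' ⟶ X}
    {r : Y' ⟶ Y}, IsPullback top l r bot → confined bot → confined top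
  indep : ∀ ⦃X Y X' Y' : C⦄ (bot : X ⟶ Y) (top : X' ⟶ Y') (l : X' ⟶ X) (r : Y' ⟶ Y), Prop
  indep_isPullback : ∀ ⦃X Y X' Y' : C⦄ {bot : X ⟶ Y} {top : X' ⟶ Y'} {l : X' ⟶ X}
    {r : Y' ⟶ Y}, indep bot top l r → IsPullback top l r bot
  indep_vert_id : ∀ ⦃X Y : C⦄ (f : X ⟶ Y), indep f f (𝟙 X) (𝟙 Y)
  indep_horiz_id : ∀ ⦃X Y : C⦄ (f : X ⟶ Y), indep (𝟙 Y) (𝟙 X) f f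
  indep_vcomp : ∀ ⦃X Y X' Y' X'' Y'' : C⦄ {f : X ⟶ Y} {f' : X' ⟶ Y'} {f'' : X'' ⟶ Y''}
    {l : X' ⟶ X} {r : Y' ⟶ Y} {l' : X'' ⟶ X'} {r' : Y'' ⟶ Y'},
    indep f f' l r → indep f' f'' l' r' → indep f f'' (l' ≫ l) (r' ≫ r)
  indep_hcomp : ∀ ⦃X Y Z X' Y' Z' : C⦄ {f : X ⟶ Y} {g : Y ⟶ Z} {f' : X' ⟶ Y'}
    {g' : Y' ⟶ Z'} {l : X' ⟶ X} {m : Y' ⟶ Y} {r : Z' ⟶ Z},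
    indep f f' l m → indep g g' m r → indep (f ≫ g) (f' ≫ g') l r
  specialized : ∀ ⦃X Y : C⦄, (X ⟶ Y) → Prop
  specialized_of_isIso : ∀ ⦃X Y : C⦄ (f : X ⟶ Y), IsIso f → specialized f
  specialized_comp : ∀ ⦃X Y Z : C⦄ {f : X ⟶ Y} {g : Y ⟶ Z},
    specialized f → specialized g → specialized (f ≫ g)

variable {C : Type u} [Category.{v} C]

/-- The structure morphism to the final object `pt`. -/
def BivFun.tm (F : BivFun C) (X : C) : X ⟶ F.pt := F.isTerminal_pt.from X

/-- The data of a bivariant theory with functoriality `F`: an abelian group for every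
morphism, bivariant pushforwards along confined morphisms, bivariant pullbacks along
independent squares, bivariant products, and units. -/
structure BivData (F : BivFun C) where
  grp : ∀ ⦃X Y : C⦄, (X ⟶ Y) → Type w
  addCommGroup : ∀ ⦃X Y : C⦄ (f : X ⟶ Y), AddCommGroup (grp f)
  push : ∀ ⦃X X' Y : C⦄ (g : X ⟶ X') (h : X' ⟶ Y), F.confined g → grp (g ≫ h) → grp h
  pull : ∀ ⦃X Y X' Y' : C⦄ {bot : X ⟶ Y} {top : X' ⟶ Y'} {l : X' ⟶ X} {r : Y' ⟶ Y},
    F.indep bot top l r → grp bot → grp top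
  mul : ∀ ⦃X Y Z : C⦄ {f : X ⟶ Y} {g : Y ⟶ Z}, grp f → grp g → grp (f ≫ g)
  one : ∀ (X : C), grp (𝟙 X)

attribute [instance] BivData.addCommGroup

variable {F : BivFun C}

/-- Transport of bivariant elements along an equality of morphisms. -/
def BivData.tr (B : BivData.{w} F) {X Y : C} {f g : X ⟶ Y} (h : f = g) :
    B.grp f → B.grp g := fun a => h ▸ a

/-- The Fulton–MacPherson bivariant axioms. -/
structure IsBivTheory (B : BivData.{w} F) : Prop where
  push_add : ∀ ⦃X X' Y : C⦄ (g : X ⟶ X') (h : X' ⟶ Y) (hg : F.confined g)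
    (α β : B.grp (g ≫ h)), B.push g h hg (α + β) = B.push g h hg α + B.push g h hg β
  pull_add : ∀ ⦃X Y X' Y' : C⦄ {bot : X ⟶ Y} {top : X' ⟶ Y'} {l : X' ⟶ X} {r : Y' ⟶ Y}
    (hsq : F.indep bot top l r) (α β : B.grp bot),
    B.pull hsq (α + β) = B.pull hsq α + B.pull hsq β
  mul_add_left : ∀ ⦃X Y Z : C⦄ {f : X ⟶ Y} {g : Y ⟶ Z} (α α' : B.grp f) (β : B.grp g),
    B.mul (α + α') β = B.mul α β + B.mul α' β
  mul_add_right : ∀ ⦃X Y Z : C⦄ {f : X ⟶ Y} {g : Y ⟶ Z} (α : B.grp f) (β β' : B.grp g),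
    B.mul α (β + β') = B.mul α β + B.mul α β'
  mul_assoc : ∀ ⦃X Y Z W : C⦄ {f : X ⟶ Y} {g : Y ⟶ Z} {h : Z ⟶ W}
    (α : B.grp f) (β : B.grp g) (γ : B.grp h),
    B.mul (B.mul α β) γ = B.tr (Category.assoc f g h).symm (B.mul α (B.mul β γ))
  push_id : ∀ ⦃X Y : C⦄ (f : X ⟶ Y) (h1 : F.confined (𝟙 X)) (α : B.grp (𝟙 X ≫ f)),
    B.push (𝟙 X) f h1 α = B.tr (Category.id_comp f) α
  push_comp : ∀ ⦃X X' X'' Y : C⦄ (f : X ⟶ X') (g : X' ⟶ X'') (h : X'' ⟶ Y)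
    (hf : F.confined f) (hg : F.confined g) (α : B.grp (f ≫ g ≫ h)),
    B.push g h hg (B.push f (g ≫ h) hf α) =
      B.push (f ≫ g) h (F.confined_comp hf hg) (B.tr (Category.assoc f g h).symm α)
  pull_id : ∀ ⦃X Y : C⦄ (f : X ⟶ Y) (α : B.grp f), B.pull (F.indep_vert_id f) α = α
  pull_comp : ∀ ⦃X Y X' Y' X'' Y'' : C⦄ {f : X ⟶ Y} {f' : X' ⟶ Y'} {f'' : X'' ⟶ Y''}
    {l : X' ⟶ X} {r : Y' ⟶ Y} {l' : X'' ⟶ X'} {r' : Y'' ⟶ Y'}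
    (h1 : F.indep f f' l r) (h2 : F.indep f' f'' l' r') (α : B.grp f),
    B.pull h2 (B.pull h1 α) = B.pull (F.indep_vcomp h1 h2) α
  push_mul : ∀ ⦃X X' Y Z : C⦄ (f : X ⟶ X') (h : X' ⟶ Y) (g : Y ⟶ Z) (hf : F.confined f)
    (α : B.grp (f ≫ h)) (β : B.grp g),
    B.push f (h ≫ g) hf (B.tr (Category.assoc f h g) (B.mul α β)) =
      B.mul (B.push f h hf α) β
  pull_mul : ∀ ⦃X Y Z X' Y' Z' : C⦄ {f : X ⟶ Y} {g : Y ⟶ Z} {f' : X' ⟶ Y'} {g' : Y' ⟶ Z'}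
    {l : X' ⟶ X} {m : Y' ⟶ Y} {r : Z' ⟶ Z}
    (h1 : F.indep f f' l m) (h2 : F.indep g g' m r) (α : B.grp f) (β : B.grp g),
    B.pull (F.indep_hcomp h1 h2) (B.mul α β) = B.mul (B.pull h1 α) (B.pull h2 β)
  push_pull : ∀ ⦃X Y Z X' Y' Z' : C⦄ (f : X ⟶ Y) (k : Y ⟶ Z) (f' : X' ⟶ Y') (k' : Y' ⟶ Z')
    (l : X' ⟶ X) (m : Y' ⟶ Y) (r : Z' ⟶ Z) (hf : F.confined f)
    (hleft : IsPullback f' l m f) (hbig : F.indep (f ≫ k) (f' ≫ k') l r)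
    (hright : F.indep k k' m r) (α : B.grp (f ≫ k)),
    B.pull hright (B.push f k hf α) =
      B.push f' k' (F.confined_pullback hleft hf) (B.pull hbig α)
  proj_formula : ∀ ⦃X Y X' Y' Z : C⦄ {b : X' ⟶ Y'} {t : X ⟶ Y} {g' : X ⟶ X'} {g : Y ⟶ Y'}
    (hsq : F.indep b t g' g) (hg : F.confined g) (c : Y' ⟶ Z)
    (α : B.grp (g ≫ c)) (β : B.grp b),
    B.push g' (b ≫ c) (F.confined_pullback (F.indep_isPullback hsq).flip hg)
        (B.tr (by rw [← Category.assoc, (F.indep_isPullback hsq).w, Category.assoc])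
          (B.mul (B.pull hsq β) α)) =
      B.mul β (B.push g c hg α)
  one_mul : ∀ ⦃X Y : C⦄ {f : X ⟶ Y} (α : B.grp f),
    B.tr (Category.id_comp f) (B.mul (B.one X) α) = α
  mul_one : ∀ ⦃X Y : C⦄ {f : X ⟶ Y} (α : B.grp f),
    B.tr (Category.comp_id f) (B.mul α (B.one Y)) = α

/-- The cohomology pullback `f^* : 𝔹^•(Y) → 𝔹^•(X)` along an arbitrary morphism, using
the independent square whose horizontal sides are `f` and whose vertical sides are
identities. -/
def cohPull (B : BivData.{w} F) {X Y : C} (f : X ⟶ Y) : B.grp (𝟙 Y) → B.grp (𝟙 X) :=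
  B.pull (F.indep_horiz_id f)

/-- The ring multiplication on the cohomology `𝔹^•(X) = 𝔹(𝟙 X)`. -/
def cohMul (B : BivData.{w} F) {X : C} (α β : B.grp (𝟙 X)) : B.grp (𝟙 X) :=
  B.tr (Category.id_comp (𝟙 X)) (B.mul α β)

/-- The homology pushforward `f_* : 𝔹_•(X) → 𝔹_•(Y)` along a confined morphism. -/
def homPush (B : BivData.{w} F) {X Y : C} (f : X ⟶ Y) (hf : F.confined f) :
    B.grp (F.tm X) → B.grp (F.tm Y) :=
  fun a => B.push f (F.tm Y) hf (B.tr (F.isTerminal_pt.hom_ext _ _) a)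

/-- The left action of the cohomology ring `𝔹^•(X)` on the homology `𝔹_•(X)`. -/
def cohSmul (B : BivData.{w} F) {X : C} (α : B.grp (𝟙 X)) (a : B.grp (F.tm X)) :
    B.grp (F.tm X) :=
  B.tr (Category.id_comp (F.tm X)) (B.mul α a)

/-- An orientation of a bivariant theory: a canonical element `θ(f)` for every
specialized morphism, normalized and multiplicative. -/
structure BivOrientation (B : BivData.{w} F) where
  θ : ∀ ⦃X Y : C⦄ (f : X ⟶ Y), F.specialized f → B.grp f
  θ_id : ∀ (X : C), θ (𝟙 X) (F.specialized_of_isIso (𝟙 X) inferInstance) = B.one X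
  θ_comp : ∀ ⦃X Y Z : C⦄ (f : X ⟶ Y) (g : Y ⟶ Z) (hf : F.specialized f)
    (hg : F.specialized g),
    θ (f ≫ g) (F.specialized_comp hf hg) = B.mul (θ f hf) (θ g hg)

/-- A stable orientation: specialized morphisms are stable under independent
pullbacks, and the orientation is stable under independent pullbacks. -/
structure StableOrientation (B : BivData.{w} F) extends BivOrientation B where
  specialized_pullback : ∀ ⦃X Y X' Y' : C⦄ {bot : X ⟶ Y} {top : X' ⟶ Y'} {l : X' ⟶ X}
    {r : Y' ⟶ Y}, F.indep bot top l r → F.specialized bot → F.specialized top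
  θ_pullback : ∀ ⦃X Y X' Y' : C⦄ {bot : X ⟶ Y} {top : X' ⟶ Y'} {l : X' ⟶ X}
    {r : Y' ⟶ Y} (hsq : F.indep bot top l r) (hs : F.specialized bot),
    B.pull hsq (θ bot hs) = θ top (specialized_pullback hsq hs)

variable {B : BivData.{w} F}

/-- The Gysin pushforward `f_! : 𝔹^•(X) → 𝔹^•(Y)`, `f_!(α) = f_*(α • θ(f))`, along a
confined and specialized morphism. -/
def BivOrientation.gysinPush (O : BivOrientation B) {X Y : C} (f : X ⟶ Y)
    (hc : F.confined f) (hs : F.specialized f) : B.grp (𝟙 X) → B.grp (𝟙 Y) :=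
  fun α => B.push f (𝟙 Y) hc
    (B.tr (show 𝟙 X ≫ f = f ≫ 𝟙 Y by simp) (B.mul α (O.θ f hs)))

/-- The Gysin pullback `g^! : 𝔹_•(Y) → 𝔹_•(X)`, `g^!(β) = θ(g) • β`, along a
specialized morphism. -/
def BivOrientation.gysinPull (O : BivOrientation B) {X Y : C} (g : X ⟶ Y)
    (hs : F.specialized g) : B.grp (F.tm Y) → B.grp (F.tm X) :=
  fun a => B.tr (F.isTerminal_pt.hom_ext _ _) (B.mul (O.θ g hs) a)

/-- `f : X ⟶ S` is a canonical inclusion into a (binary) coproduct. -/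
def IsCoprodIncl {X S : C} (f : X ⟶ S) : Prop :=
  ∃ (Y : C) (g : Y ⟶ S),
    Nonempty (IsColimit (BinaryCofan.mk f g)) ∨ Nonempty (IsColimit (BinaryCofan.mk g f))

/-- The bivariant functoriality has good coproducts: `𝒞` has finite coproducts; no
non-initial object maps to an initial object; a morphism out of a coproduct is
confined (resp. specialized) iff both of its restrictions are; the squares expressing
disjointness of the canonical inclusions and the base change of a coproduct
decomposition are Cartesian; and every Cartesian square having a canonical coproduct
inclusion as a side is independent. -/
structure GoodCoproducts (F : BivFun C) : Prop where
  hasInitial : HasInitial C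
  hasBinaryCoproducts : HasBinaryCoproducts C
  no_map_to_initial : ∀ ⦃X E : C⦄, IsInitial E → (X ⟶ E) → Nonempty (IsInitial X)
  confined_iff : ∀ ⦃X Y S Z : C⦄ (ι₁ : X ⟶ S) (ι₂ : Y ⟶ S),
    Nonempty (IsColimit (BinaryCofan.mk ι₁ ι₂)) → ∀ (f : S ⟶ Z),
    (F.confined f ↔ F.confined (ι₁ ≫ f) ∧ F.confined (ι₂ ≫ f))
  specialized_iff : ∀ ⦃X Y S Z : C⦄ (ι₁ : X ⟶ S) (ι₂ : Y ⟶ S),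
    Nonempty (IsColimit (BinaryCofan.mk ι₁ ι₂)) → ∀ (f : S ⟶ Z),
    (F.specialized f ↔ F.specialized (ι₁ ≫ f) ∧ F.specialized (ι₂ ≫ f))
  disjoint_cartesian : ∀ ⦃X Y S E : C⦄ (ι₁ : X ⟶ S) (ι₂ : Y ⟶ S),
    Nonempty (IsColimit (BinaryCofan.mk ι₁ ι₂)) → ∀ (hE : IsInitial E),
    IsPullback (hE.to X) (hE.to Y) ι₁ ι₂
  basechange_cartesian : ∀ ⦃X Y S Z Z' X' Y' S' : C⦄ (ι₁ : X ⟶ S) (ι₂ : Y ⟶ S),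
    Nonempty (IsColimit (BinaryCofan.mk ι₁ ι₂)) →
    ∀ (f : S ⟶ Z) (g : Z' ⟶ Z) (pX : X' ⟶ X) (qX : X' ⟶ Z') (pY : Y' ⟶ Y)
      (qY : Y' ⟶ Z'),
    IsPullback qX pX g (ι₁ ≫ f) → IsPullback qY pY g (ι₂ ≫ f) →
    ∀ (ι₁' : X' ⟶ S') (ι₂' : Y' ⟶ S'),
    Nonempty (IsColimit (BinaryCofan.mk ι₁' ι₂')) →
    ∀ (t : S' ⟶ Z') (l : S' ⟶ S), ι₁' ≫ t = qX → ι₂' ≫ t = qY →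
      ι₁' ≫ l = pX ≫ ι₁ → ι₂' ≫ l = pY ≫ ι₂ → IsPullback t l g f
  incl_indep : ∀ ⦃X Y X' Y' : C⦄ {bot : X ⟶ Y} {top : X' ⟶ Y'} {l : X' ⟶ X}
    {r : Y' ⟶ Y}, IsPullback top l r bot →
    (IsCoprodIncl bot ∨ IsCoprodIncl top ∨ IsCoprodIncl l ∨ IsCoprodIncl r) →
    F.indep bot top l r

/-- A well oriented and additive bivariant theory over a functoriality with good
coproducts: the orientations of the canonical coproduct inclusions are stable under
independent pullbacks, and for every finite coproduct `X = ⨿ᵢ Xᵢ` with canonical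
inclusions `ιᵢ` (which are confined and specialized) one has
`Σᵢ ιᵢ_*(θ(ιᵢ)) = 1_X`. -/
structure IsAdditive (B : BivData.{w} F) (O : BivOrientation B)
    (D : GoodCoproducts F) : Prop where
  well_oriented : ∀ ⦃X Y X' Y' : C⦄ {bot : X ⟶ Y} {top : X' ⟶ Y'} {l : X' ⟶ X}
    {r : Y' ⟶ Y} (hsq : F.indep bot top l r), IsCoprodIncl bot →
    ∀ (hbs : F.specialized bot) (hts : F.specialized top),
    B.pull hsq (O.θ bot hbs) = O.θ top hts
  additive : ∀ (n : ℕ) (Xs : Fin n → C) (S : C) (ι : ∀ i, Xs i ⟶ S),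
    Nonempty (IsColimit (Cofan.mk S ι)) →
    ∀ (hc : ∀ i, F.confined (ι i)) (hs : ∀ i, F.specialized (ι i)),
    (Finset.univ.sum fun i =>
      B.push (ι i) (𝟙 S) (hc i)
        (B.tr (Category.comp_id (ι i)).symm (O.θ (ι i) (hs i)))) = B.one S

section Transport

variable {C : Type u} [Category.{v} C] {F : BivFun C} (B : BivData.{w} F)

theorem BivData.tr_tr {X Y : C} {f g h : X ⟶ Y} (e : f = g) (e' : g = h) (a : B.grp f) :
    B.tr e' (B.tr e a) = B.tr (e.trans e') a := by
  subst e; subst e'; rfl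

theorem BivData.tr_zero {X Y : C} {f g : X ⟶ Y} (e : f = g) : B.tr e 0 = 0 := by
  subst e; rfl

theorem BivData.tr_add {X Y : C} {f g : X ⟶ Y} (e : f = g) (a b : B.grp f) :
    B.tr e (a + b) = B.tr e a + B.tr e b := by
  subst e; rfl

theorem BivData.push_tr {X X' Y : C} (g : X ⟶ X') {h h' : X' ⟶ Y} (e : h = h')
    (hg : F.confined g) (e' : g ≫ h = g ≫ h') (a : B.grp (g ≫ h)) :
    B.push g h' hg (B.tr e' a) = B.tr e (B.push g h hg a) := by
  subst e; rfl

theorem BivData.pull_tr {X Y X' Y' : C} {bot bot' : X ⟶ Y} {top top' : X' ⟶ Y'}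
    {l : X' ⟶ X} {r : Y' ⟶ Y} (e : bot = bot') (e' : top = top')
    (hsq : F.indep bot top l r) (hsq' : F.indep bot' top' l r) (a : B.grp bot) :
    B.pull hsq' (B.tr e a) = B.tr e' (B.pull hsq a) := by
  subst e; subst e'; rfl

theorem BivData.mul_tr {X Y Z : C} {f : X ⟶ Y} {g g' : Y ⟶ Z} (e : g = g')
    (e' : f ≫ g = f ≫ g') (a : B.grp f) (b : B.grp g) :
    B.mul a (B.tr e b) = B.tr e' (B.mul a b) := by
  subst e; rfl

end Transport

section Coproducts

variable {C : Type u} [Category.{v} C] {F : BivFun C} {B : BivData.{w} F}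

theorem GoodCoproducts.mono_inl (D : GoodCoproducts F) {Y₁ Y₂ S : C} {ι₁ : Y₁ ⟶ S}
    {ι₂ : Y₂ ⟶ S} (hS : Nonempty (IsColimit (BinaryCofan.mk ι₁ ι₂))) : Mono ι₁ := by
  have := F.hasPullbacks
  have := D.hasInitial
  have hE : IsInitial (⊥_ C) := initialIsInitial
  have h1 : IsPullback (pullback.fst ι₁ ι₁) (pullback.snd ι₁ ι₁) ι₁ (ι₁ ≫ 𝟙 S) := by
    simpa using IsPullback.of_hasPullback ι₁ ι₁
  have h2 : IsPullback (hE.to Y₁) (hE.to Y₂) ι₁ (ι₂ ≫ 𝟙 S) := by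
    simpa using D.disjoint_cartesian ι₁ ι₂ hS hE
  have hcol : Nonempty (IsColimit
      (BinaryCofan.mk (𝟙 (pullback ι₁ ι₁)) (hE.to (pullback ι₁ ι₁)))) :=
    ⟨BinaryCofan.isColimitMk (fun s => s.inl) (fun s => Category.id_comp s.inl)
      (fun s => hE.hom_ext _ _) (fun s m h _ => (Category.id_comp m).symm.trans h)⟩
  have hpb := D.basechange_cartesian ι₁ ι₂ hS (𝟙 S) ι₁ _ _ _ _ h1 h2 _ _ hcol
    (pullback.fst ι₁ ι₁) (pullback.fst ι₁ ι₁ ≫ ι₁) (by simp) (hE.hom_ext _ _)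
    (by simp [pullback.condition]) (hE.hom_ext _ _)
  have : IsIso (pullback.fst ι₁ ι₁) := hpb.isIso_fst_of_isIso
  exact IsKernelPair.mono_of_isIso_fst (IsPullback.of_hasPullback ι₁ ι₁)

theorem IsAdditive.eq_zero_of_isInitial (hB : IsBivTheory B) {D : GoodCoproducts F}
    {O : BivOrientation B} (hAdd : IsAdditive B O D) {E Y : C} (hE : IsInitial E)
    {f : E ⟶ Y} (a : B.grp f) : a = 0 := by
  have h1 : B.one E = 0 := by
    have h := hAdd.additive 0 (fun i => i.elim0) E (fun i => i.elim0)
      ⟨Cofan.IsColimit.mk _ (fun s => hE.to _) (fun s i => i.elim0)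
        (fun s m _ => hE.hom_ext _ _)⟩ (fun i => i.elim0) (fun i => i.elim0)
    simpa using h.symm
  have h0 : B.mul (0 : B.grp (𝟙 E)) a = 0 := by
    simpa using hB.mul_add_left (0 : B.grp (𝟙 E)) 0 a
  rw [← hB.one_mul a, h1, h0, B.tr_zero]

theorem IsAdditive.push_θ_add_push_θ {D : GoodCoproducts F}
    {O : BivOrientation B} (hAdd : IsAdditive B O D) {Y₁ Y₂ S : C} {ι₁ : Y₁ ⟶ S}
    {ι₂ : Y₂ ⟶ S} (hS : Nonempty (IsColimit (BinaryCofan.mk ι₁ ι₂)))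
    (hc₁ : F.confined ι₁) (hc₂ : F.confined ι₂)
    (hs₁ : F.specialized ι₁) (hs₂ : F.specialized ι₂) :
    B.push ι₁ (𝟙 S) hc₁ (B.tr (Category.comp_id ι₁).symm (O.θ ι₁ hs₁)) +
      B.push ι₂ (𝟙 S) hc₂ (B.tr (Category.comp_id ι₂).symm (O.θ ι₂ hs₂)) = B.one S := by
  obtain ⟨hS⟩ := hS
  let Xs : Fin 2 → C := ![Y₁, Y₂]
  let ι : ∀ i, Xs i ⟶ S := fun i => match i with
    | 0 => ι₁
    | 1 => ι₂
  have hcol : IsColimit (Cofan.mk S ι) := by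
    refine Cofan.IsColimit.mk _ (fun s => (BinaryCofan.IsColimit.desc' hS (s.inj 0) (s.inj 1)).1)
      (fun s i => ?_) (fun s m hm => ?_)
    · fin_cases i
      · exact (BinaryCofan.IsColimit.desc' hS (s.inj 0) (s.inj 1)).2.1
      · exact (BinaryCofan.IsColimit.desc' hS (s.inj 0) (s.inj 1)).2.2
    · apply BinaryCofan.IsColimit.hom_ext hS
      · exact (hm 0).trans (BinaryCofan.IsColimit.desc' hS (s.inj 0) (s.inj 1)).2.1.symm
      · exact (hm 1).trans (BinaryCofan.IsColimit.desc' hS (s.inj 0) (s.inj 1)).2.2.symm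
  have h := hAdd.additive 2 Xs S ι ⟨hcol⟩
    (fun i => match i with
      | 0 => hc₁
      | 1 => hc₂)
    (fun i => match i with
      | 0 => hs₁
      | 1 => hs₂)
  rw [Fin.sum_univ_two] at h
  exact h

/-- The projection formula for `g_*(g^*(α) • β)`, with the target composed with the
identity. -/
theorem IsBivTheory.push_pull_mul (hB : IsBivTheory B) {X Y X' S : C} {φ : X ⟶ S}
    {ι : Y ⟶ S} {p : X' ⟶ Y} {ι' : X' ⟶ X} (hsq : F.indep φ p ι' ι) (hc : F.confined ι)
    (hc' : F.confined ι') (e : p ≫ ι = ι' ≫ φ) (α : B.grp φ) (β : B.grp ι) :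
    B.push ι' φ hc' (B.tr e (B.mul (B.pull hsq α) β)) =
      B.tr (Category.comp_id φ)
        (B.mul α (B.push ι (𝟙 S) hc (B.tr (Category.comp_id ι).symm β))) := by
  rw [← hB.proj_formula hsq hc (𝟙 S), ← B.push_tr ι' (Category.comp_id φ) _ (by simp),
    B.mul_tr _ (by simp), B.tr_tr, B.tr_tr]

theorem IsAdditive.pull_push_self (hB : IsBivTheory B) {D : GoodCoproducts F}
    {O : BivOrientation B} (hAdd : IsAdditive B O D) {X Y X' S : C} {φ : X ⟶ S}
    {ι : Y ⟶ S} {p : X' ⟶ Y} {ι' : X' ⟶ X} [Mono ι] (hι : IsCoprodIncl ι)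
    (hsq : F.indep φ p ι' ι) (hc' : F.confined ι') (hs : F.specialized ι)
    (e : p ≫ ι = ι' ≫ φ) (α : B.grp p) :
    B.pull hsq (B.push ι' φ hc' (B.tr e (B.mul α (O.θ ι hs)))) = α := by
  have hpb := F.indep_isPullback hsq
  have : Mono ι' := ⟨fun g h w => hpb.hom_ext
    (by rw [← cancel_mono ι, Category.assoc, Category.assoc, hpb.w, reassoc_of% w]) w⟩
  have hleft : IsPullback (𝟙 X') (𝟙 X') ι' ι' := IsKernelPair.id_of_mono ι'
  have hdiag : F.indep ι (𝟙 Y) (𝟙 Y) ι :=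
    D.incl_indep (IsKernelPair.id_of_mono ι) (Or.inl hι)
  have hbig : F.indep (ι' ≫ φ) (𝟙 X' ≫ p) (𝟙 X') ι :=
    D.incl_indep (hleft.paste_horiz hpb) (Or.inr (Or.inr (Or.inr hι)))
  rw [hB.push_pull ι' φ (𝟙 X') p (𝟙 X') ι' ι hc' hleft hbig hsq,
    B.pull_tr e (by simp) (F.indep_hcomp (F.indep_vert_id p) hdiag) hbig,
    hB.pull_mul (F.indep_vert_id p) hdiag, hB.pull_id, hAdd.well_oriented hdiag hι hs
      (F.specialized_of_isIso (𝟙 Y) inferInstance), O.θ_id, hB.push_id, B.tr_tr]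
  exact hB.mul_one α

theorem IsAdditive.pull_push_disjoint (hB : IsBivTheory B) {D : GoodCoproducts F}
    {O : BivOrientation B} (hAdd : IsAdditive B O D) {X Y₁ Y₂ X₁ X₂ S : C} {φ : X ⟶ S}
    {ι₁ : Y₁ ⟶ S} {ι₂ : Y₂ ⟶ S} (hS : Nonempty (IsColimit (BinaryCofan.mk ι₁ ι₂)))
    {p₁ : X₁ ⟶ Y₁} {ι'₁ : X₁ ⟶ X} {p₂ : X₂ ⟶ Y₂} {ι'₂ : X₂ ⟶ X}
    (h₁ : F.indep φ p₁ ι'₁ ι₁) (e : p₂ ≫ ι₂ = ι'₂ ≫ φ)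
    (hc' : F.confined ι'₂) (α : B.grp (ι'₂ ≫ φ)) :
    B.pull h₁ (B.push ι'₂ φ hc' α) = 0 := by
  have := F.hasPullbacks
  have := D.hasInitial
  have hpb := F.indep_isPullback h₁
  have hleft := IsPullback.of_hasPullback ι'₁ ι'₂
  have hdis := D.disjoint_cartesian ι₁ ι₂ hS initialIsInitial
  obtain ⟨hP⟩ := D.no_map_to_initial initialIsInitial
    (hdis.lift (pullback.fst ι'₁ ι'₂ ≫ p₁) (pullback.snd ι'₁ ι'₂ ≫ p₂)
      (by rw [Category.assoc, Category.assoc, hpb.w, e, pullback.condition_assoc]))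
  have hbig : F.indep (ι'₂ ≫ φ) (pullback.fst ι'₁ ι'₂ ≫ p₁) (pullback.snd ι'₁ ι'₂) ι₁ :=
    D.incl_indep (hleft.paste_horiz hpb) (Or.inr (Or.inr (Or.inr ⟨Y₂, ι₂, Or.inl hS⟩)))
  rw [hB.push_pull ι'₂ φ _ p₁ _ ι'₁ ι₁ hc' hleft hbig h₁,
    IsAdditive.eq_zero_of_isInitial hB hAdd hP (B.pull hbig α)]
  simpa using hB.push_add (pullback.fst ι'₁ ι'₂) p₁ (F.confined_pullback hleft hc') 0 0

end Coproducts

/-- Let `𝔹` be an additive bivariant theory over a functoriality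
with good coproducts, let `φ : X ⟶ Y₁ ⊔ Y₂` be a morphism, and let
`Xᵢ = X ×_{Y₁ ⊔ Y₂} Yᵢ` with induced maps `ι'ᵢ : Xᵢ ⟶ X` and projections
`pᵢ : Xᵢ ⟶ Yᵢ`, where `ιᵢ : Yᵢ ⟶ Y₁ ⊔ Y₂` are the canonical inclusions (confined
and specialized).  Then `(ι₁^*, ι₂^*) : 𝔹(X → Y₁ ⊔ Y₂) → 𝔹(X₁ → Y₁) ⊕ 𝔹(X₂ → Y₂)`
is an isomorphism, whose inverse sends `(α₁, α₂)` to
`ι'₁_*(α₁ • θ(ι₁)) + ι'₂_*(α₂ • θ(ι₂))`. -/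
theorem additive_theory_target_coproduct_decomposition {C : Type u} [Category.{v} C]
    (F : BivFun C) (B : BivData.{w} F) (hB : IsBivTheory B)
    (D : GoodCoproducts F) (O : BivOrientation B) (hAdd : IsAdditive B O D)
    (X Y₁ Y₂ S : C) (ι₁ : Y₁ ⟶ S) (ι₂ : Y₂ ⟶ S)
    (hS : Nonempty (IsColimit (BinaryCofan.mk ι₁ ι₂)))
    (φ : X ⟶ S)
    (X₁ : C) (p₁ : X₁ ⟶ Y₁) (ι'₁ : X₁ ⟶ X) (hPB₁ : IsPullback p₁ ι'₁ ι₁ φ)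
    (X₂ : C) (p₂ : X₂ ⟶ Y₂) (ι'₂ : X₂ ⟶ X) (hPB₂ : IsPullback p₂ ι'₂ ι₂ φ)
    (hcι₁ : F.confined ι₁) (hcι₂ : F.confined ι₂)
    (hsι₁ : F.specialized ι₁) (hsι₂ : F.specialized ι₂) :
    Function.Bijective
      (fun α : B.grp φ =>
        (B.pull (D.incl_indep hPB₁ (Or.inr (Or.inr (Or.inr ⟨Y₂, ι₂, Or.inl hS⟩)))) α,
         B.pull (D.incl_indep hPB₂
            (Or.inr (Or.inr (Or.inr ⟨Y₁, ι₁, Or.inr hS⟩)))) α)) ∧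
    (∀ α : B.grp φ,
      B.push ι'₁ φ (F.confined_pullback hPB₁.flip hcι₁)
          (B.tr hPB₁.w
            (B.mul (B.pull (D.incl_indep hPB₁
              (Or.inr (Or.inr (Or.inr ⟨Y₂, ι₂, Or.inl hS⟩)))) α) (O.θ ι₁ hsι₁))) +
        B.push ι'₂ φ (F.confined_pullback hPB₂.flip hcι₂)
          (B.tr hPB₂.w
            (B.mul (B.pull (D.incl_indep hPB₂
              (Or.inr (Or.inr (Or.inr ⟨Y₁, ι₁, Or.inr hS⟩)))) α) (O.θ ι₂ hsι₂))) =
        α) ∧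
    (∀ (α₁ : B.grp p₁) (α₂ : B.grp p₂),
      B.pull (D.incl_indep hPB₁ (Or.inr (Or.inr (Or.inr ⟨Y₂, ι₂, Or.inl hS⟩))))
          (B.push ι'₁ φ (F.confined_pullback hPB₁.flip hcι₁)
              (B.tr hPB₁.w (B.mul α₁ (O.θ ι₁ hsι₁))) +
            B.push ι'₂ φ (F.confined_pullback hPB₂.flip hcι₂)
              (B.tr hPB₂.w (B.mul α₂ (O.θ ι₂ hsι₂)))) = α₁ ∧
      B.pull (D.incl_indep hPB₂ (Or.inr (Or.inr (Or.inr ⟨Y₁, ι₁, Or.inr hS⟩))))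
          (B.push ι'₁ φ (F.confined_pullback hPB₁.flip hcι₁)
              (B.tr hPB₁.w (B.mul α₁ (O.θ ι₁ hsι₁))) +
            B.push ι'₂ φ (F.confined_pullback hPB₂.flip hcι₂)
              (B.tr hPB₂.w (B.mul α₂ (O.θ ι₂ hsι₂)))) = α₂) := by
  have hS' : Nonempty (IsColimit (BinaryCofan.mk ι₂ ι₁)) :=
    hS.map BinaryCofan.isColimitFlip
  have := D.mono_inl hS
  have := D.mono_inl hS'
  have left_inv : ∀ α : B.grp φ,
      B.push ι'₁ φ (F.confined_pullback hPB₁.flip hcι₁)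
          (B.tr hPB₁.w
            (B.mul (B.pull (D.incl_indep hPB₁
              (Or.inr (Or.inr (Or.inr ⟨Y₂, ι₂, Or.inl hS⟩)))) α) (O.θ ι₁ hsι₁))) +
        B.push ι'₂ φ (F.confined_pullback hPB₂.flip hcι₂)
          (B.tr hPB₂.w
            (B.mul (B.pull (D.incl_indep hPB₂
              (Or.inr (Or.inr (Or.inr ⟨Y₁, ι₁, Or.inr hS⟩)))) α) (O.θ ι₂ hsι₂))) =
        α := fun α => by
    rw [hB.push_pull_mul _ hcι₁, hB.push_pull_mul _ hcι₂, ← B.tr_add, ← hB.mul_add_right,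
      hAdd.push_θ_add_push_θ hS, hB.mul_one]
  have right_inv : ∀ (α₁ : B.grp p₁) (α₂ : B.grp p₂),
      B.pull (D.incl_indep hPB₁ (Or.inr (Or.inr (Or.inr ⟨Y₂, ι₂, Or.inl hS⟩))))
          (B.push ι'₁ φ (F.confined_pullback hPB₁.flip hcι₁)
              (B.tr hPB₁.w (B.mul α₁ (O.θ ι₁ hsι₁))) +
            B.push ι'₂ φ (F.confined_pullback hPB₂.flip hcι₂)
              (B.tr hPB₂.w (B.mul α₂ (O.θ ι₂ hsι₂)))) = α₁ ∧
      B.pull (D.incl_indep hPB₂ (Or.inr (Or.inr (Or.inr ⟨Y₁, ι₁, Or.inr hS⟩))))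
          (B.push ι'₁ φ (F.confined_pullback hPB₁.flip hcι₁)
              (B.tr hPB₁.w (B.mul α₁ (O.θ ι₁ hsι₁))) +
            B.push ι'₂ φ (F.confined_pullback hPB₂.flip hcι₂)
              (B.tr hPB₂.w (B.mul α₂ (O.θ ι₂ hsι₂)))) = α₂ := fun α₁ α₂ => by
    constructor
    · rw [hB.pull_add, hAdd.pull_push_self hB ⟨Y₂, ι₂, Or.inl hS⟩,
        hAdd.pull_push_disjoint hB hS _ hPB₂.w, add_zero]
    · rw [hB.pull_add, hAdd.pull_push_self hB ⟨Y₁, ι₁, Or.inr hS⟩,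
        hAdd.pull_push_disjoint hB hS' _ hPB₁.w, zero_add]
  refine ⟨⟨fun α β h => ?_, fun ⟨α₁, α₂⟩ => ⟨_, Prod.ext (right_inv α₁ α₂).1
    (right_inv α₁ α₂).2⟩⟩, left_inv, right_inv⟩
  obtain ⟨h₁, h₂⟩ := Prod.ext_iff.mp h
  dsimp only at h₁ h₂
  rw [← left_inv α, ← left_inv β, h₁, h₂]
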